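/- Let 0 < ε < 1, κ ∈ ℝ, and let a(t) = −t^{1/ε}·log t for 0 < t < 1. Then lim_{t→0⁺} t^{2/ε}·(log t)²·(a''(t)/a(t) − a'(t)²/a(t)² − κ/a(t)²) = −κ. -/

import Mathlib

open Filter Topology Set MeasureTheory intervalIntegral

theorem hasDerivAt_neg_rpow_mul_log (p : ℝ) {t : ℝ} (ht : 0 < t) :
    HasDerivAt (fun u : ℝ => -(u ^ p) * Real.log u)
      (-(t ^ (p - 1) * (p * Real.log t + 1))) t := by
  have h := (Real.hasDerivAt_rpow_const (p := p) (Or.inl ht.ne')).neg.mul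
    (Real.hasDerivAt_log ht.ne')
  refine h.congr_deriv ?_
  simp only [Pi.neg_apply]
  rw [Real.rpow_sub_one ht.ne']
  field_simp
  ring

theorem deriv_deriv_neg_rpow_mul_log (p : ℝ) {t : ℝ} (ht : 0 < t) :
    deriv (deriv fun u : ℝ => -(u ^ p) * Real.log u) t =
      -((p - 1) * t ^ (p - 1 - 1) * (p * Real.log t + 1) + t ^ (p - 1) * (p * t⁻¹)) := by
  have heq : (deriv fun u : ℝ => -(u ^ p) * Real.log u) =ᶠ[𝓝 t]
      fun u => -(u ^ (p - 1) * (p * Real.log u + 1)) := by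
    filter_upwards [Ioi_mem_nhds ht] with u hu
    exact (hasDerivAt_neg_rpow_mul_log p hu).deriv
  rw [heq.deriv_eq]
  exact ((Real.hasDerivAt_rpow_const (p := p - 1) (Or.inl ht.ne')).mul
    (((Real.hasDerivAt_log ht.ne').const_mul p).add_const 1)).neg.deriv

/-- Paper's asymptotic claim (Eq. 64, case `0 < ε < 1`) for the logarithmically
corrected scale factor `a(t) = -t^(1/ε) * log t` near the singularity: the
curvature term `-κ/(t^(2/ε) (log t)²)` dominates. -/
theorem log_corrected_asymptotics_eps_lt_one
    (ε : ℝ) (hε0 : 0 < ε) (hε1 : ε < 1) (κ : ℝ)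
    (a : ℝ → ℝ) (ha : a = fun u => -(u ^ (1 / ε)) * Real.log u) :
    Tendsto (fun t => t ^ (2 / ε) * (Real.log t) ^ 2 *
        (deriv (deriv a) t / a t - (deriv a t) ^ 2 / (a t) ^ 2 - κ / (a t) ^ 2))
      (𝓝[>] (0 : ℝ)) (𝓝 (-κ)) := by
  have hp : 0 < 1 / ε - 1 := sub_pos.2 ((one_lt_div hε0).2 hε1)
  have hpow : (2 / ε : ℝ) = 1 / ε + 1 / ε := by ring
  rw [hpow]
  generalize 1 / ε = p at *
  subst ha
  have hlog := tendsto_log_mul_rpow_nhdsGT_zero hp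
  have hs : Tendsto (fun t : ℝ => t ^ (p - 1)) (𝓝[>] 0) (𝓝 0) := by
    have h := (Real.continuousAt_rpow_const 0 (p - 1) (Or.inr hp.le)).tendsto
    rw [Real.zero_rpow hp.ne'] at h
    exact h.mono_left nhdsWithin_le_nhds
  have hlim := ((((hlog.pow 2).const_mul p).add (hlog.mul hs)).add (hs.pow 2)).neg.sub_const κ
  norm_num at hlim
  refine hlim.congr' ?_
  filter_upwards [Ioo_mem_nhdsGT (zero_lt_one' ℝ)] with t ht
  have ht0 : t ≠ 0 := ht.1.ne'
  have hL : Real.log t ≠ 0 := (Real.log_neg ht.1 ht.2).ne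
  rw [deriv_deriv_neg_rpow_mul_log p ht.1, (hasDerivAt_neg_rpow_mul_log p ht.1).deriv,
    Real.rpow_add ht.1, Real.rpow_sub_one ht0 (p - 1), Real.rpow_sub_one ht0 p]
  have hx : t ^ p ≠ 0 := (Real.rpow_pos_of_pos ht.1 p).ne'
  generalize t ^ p = x at *
  generalize Real.log t = l at *
  field_simp
  ring
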